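/- Suppose {y[a1,a2]}_{(a1,a2)∈ℤ²} is a family of elements of A(P1,P2) such that each y[a1,a2] is pointed at (a1,a2) and y[a1,a2] = z_1[a1,a2] for every (a1,a2) ∈ ℤ² ∖ ℤ_{>0}² (a complete bounded collection of pointed elements). Then {y[a1,a2] : (a1,a2) ∈ ℤ²} is an underline-K-basis of A(P1,P2). -/

import Mathlib

open Polynomial
noncomputable section

namespace GCA

/-- The ambient field of rational functions in two variables over `K`. -/
abbrev F (K : Type*) [Field K] := FractionRing (MvPolynomial (Fin 2) K)

/-- The canonical embedding of `K` into `F K`. -/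
def φ (K : Type*) [Field K] : K →+* F K :=
  (algebraMap (MvPolynomial (Fin 2) K) (F K)).comp (MvPolynomial.C)

/-- The two variables `x1, x2` in `F K`. -/
def Xv (K : Type*) [Field K] (i : Fin 2) : F K :=
  algebraMap (MvPolynomial (Fin 2) K) (F K) (MvPolynomial.X i)

/-- A polynomial of degree `d` is palindromic if `P(z) = z^d P(1/z)`. -/
def Palindromic {K : Type*} [Field K] (P : K[X]) : Prop :=
  ∀ t ≤ P.natDegree, P.coeff t = P.coeff (P.natDegree - t)

/-- `x : ℤ → F K` is the sequence of cluster variables for the exchange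
polynomials `P1, P2`. -/
def ClusterSeq {K : Type*} [Field K] (P1 P2 : K[X]) (x : ℤ → F K) : Prop :=
  x 1 = Xv K 0 ∧ x 2 = Xv K 1 ∧ (∀ k, x k ≠ 0) ∧
    ∀ k : ℤ, x (k + 1) * x (k - 1) =
      if Even k then Polynomial.eval₂ (φ K) (x k) P1 else Polynomial.eval₂ (φ K) (x k) P2

/-- `underline-K`: the ℤ-subalgebra (subring) of `K` generated by the coefficients
of `P1` and `P2`. -/
def uK {K : Type*} [Field K] (P1 P2 : K[X]) : Subring K :=
  Subring.closure (Set.range P1.coeff ∪ Set.range P2.coeff)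

/-- The generalized cluster algebra `A(P1,P2)`: the `uK`-subalgebra of `F K`
generated by the cluster variables, as a subring of `F K`. -/
def clA {K : Type*} [Field K] (P1 P2 : K[X]) (x : ℤ → F K) : Subring (F K) :=
  Subring.closure (φ K '' (uK P1 P2 : Set K) ∪ Set.range x)

/-- The Laurent polynomial ring `T k` in the cluster `{x k, x (k+1)}`. -/
def clT {K : Type*} [Field K] (P1 P2 : K[X]) (x : ℤ → F K) (k : ℤ) : Subring (F K) :=
  Subring.closure (φ K '' (uK P1 P2 : Set K) ∪ {x k, (x k)⁻¹, x (k + 1), (x (k + 1))⁻¹})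

/-- The standard monomial `z_k[a1,a2]`. -/
def zmon {K : Type*} [Field K] (x : ℤ → F K) (k a1 a2 : ℤ) : F K :=
  x (k - 1) ^ (max a2 0).toNat * x k ^ (max (-a1) 0).toNat *
    x (k + 1) ^ (max (-a2) 0).toNat * x (k + 2) ^ (max a1 0).toNat

/-- `y` is pointed at `(a1, a2)` with coefficient function `c`. -/
def PointedAt {K : Type*} [Field K] (P1 P2 : K[X]) (x : ℤ → F K) (a1 a2 : ℤ)
    (c : ℕ × ℕ →₀ K) (y : F K) : Prop :=
  (∀ m, c m ∈ uK P1 P2) ∧ c (0, 0) = 1 ∧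
    y = x 1 ^ (-a1) * x 2 ^ (-a2) *
      ∑ m ∈ c.support, φ K (c m) * x 1 ^ m.1 * x 2 ^ m.2

section LowestTerms

variable {K : Type*} [Field K]

lemma Xv_ne_zero (i : Fin 2) : Xv K i ≠ 0 := by
  simp [Xv, MvPolynomial.X_ne_zero]

lemma algebraMap_eq_φ (r : K) : algebraMap K (F K) r = φ K r :=
  IsScalarTower.algebraMap_apply K (MvPolynomial (Fin 2) K) (F K) r

lemma smul_eq_φ_mul (S : Subring K) (r : S) (w : F K) : r • w = φ K r * w := by
  rw [Algebra.smul_def, ← algebraMap_eq_φ]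
  rfl

/-- `w` is a Laurent polynomial in the two variables over `K` with lowest term `x1^(-a1) x2^(-a2)`,
all other exponents being larger in the product order. -/
def Lowest (a : ℤ × ℤ) (w : F K) : Prop :=
  ∃ p : MvPolynomial (Fin 2) K, MvPolynomial.constantCoeff p = 1 ∧
    w = Xv K 0 ^ (-a.1) * Xv K 1 ^ (-a.2) * algebraMap _ (F K) p

lemma Lowest.one : Lowest (K := K) 0 1 := ⟨1, by simp, by simp⟩

lemma Lowest.mul {a b : ℤ × ℤ} {v w : F K} (hv : Lowest a v) (hw : Lowest b w) :
    Lowest (a + b) (v * w) := by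
  obtain ⟨p, hp, rfl⟩ := hv
  obtain ⟨q, hq, rfl⟩ := hw
  refine ⟨p * q, by simp [hp, hq], ?_⟩
  rw [Prod.fst_add, Prod.snd_add, neg_add, neg_add, zpow_add₀ (Xv_ne_zero 0),
    zpow_add₀ (Xv_ne_zero 1), map_mul]
  ring

lemma Lowest.pow {a : ℤ × ℤ} {v : F K} (hv : Lowest a v) (n : ℕ) : Lowest (n • a) (v ^ n) := by
  induction n with
  | zero => simpa using Lowest.one
  | succ n ih => rw [succ_nsmul, pow_succ]; exact ih.mul hv

/-- Clearing denominators in a Laurent polynomial with a given lowest term. -/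
lemma Xv_pow_mul_zpow (N : ℕ) (d : ℤ × ℤ) (h1 : d.1 ≤ N) (h2 : d.2 ≤ N)
    (p : MvPolynomial (Fin 2) K) :
    Xv K 0 ^ N * Xv K 1 ^ N * (Xv K 0 ^ (-d.1) * Xv K 1 ^ (-d.2) * algebraMap _ (F K) p) =
      algebraMap _ (F K) (MvPolynomial.monomial (Finsupp.single 0 (N - d.1).toNat +
        Finsupp.single 1 (N - d.2).toNat) 1 * p) := by
  have key (i : Fin 2) (e : ℤ) (he : e ≤ N) :
      Xv K i ^ N * Xv K i ^ (-e) = Xv K i ^ (N - e).toNat := by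
    rw [← zpow_natCast, ← zpow_natCast, ← zpow_add₀ (Xv_ne_zero i), Int.toNat_of_nonneg (by lia),
      sub_eq_add_neg]
  have hm : algebraMap (MvPolynomial (Fin 2) K) (F K) (MvPolynomial.monomial (Finsupp.single 0 (N - d.1).toNat +
        Finsupp.single 1 (N - d.2).toNat) (1 : K)) =
      Xv K 0 ^ (N - d.1).toNat * Xv K 1 ^ (N - d.2).toNat := by
    have := MvPolynomial.monomial_mul (s := Finsupp.single (0 : Fin 2) (N - d.1).toNat)
      (s' := Finsupp.single 1 (N - d.2).toNat) (a := (1 : K)) (b := 1)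
    rw [mul_one] at this
    rw [← this, map_mul, ← MvPolynomial.X_pow_eq_monomial, ← MvPolynomial.X_pow_eq_monomial,
      map_pow, map_pow]
    rfl
  rw [map_mul, hm, ← key 0 _ h1, ← key 1 _ h2]
  ring

/-- In a vanishing combination of Laurent polynomials with lowest terms, the coefficients of the
elements with a given maximal denominator vector add up to zero. -/
lemma sum_filter_eq_zero_of_lowest {ι : Type*} (s : Finset ι) (c : ι → K) (d : ι → ℤ × ℤ)
    (w : ι → F K) (hw : ∀ i ∈ s, Lowest (d i) (w i)) (h : ∑ i ∈ s, φ K (c i) * w i = 0)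
    (a : ℤ × ℤ) (ha : ∀ i ∈ s, c i ≠ 0 → a ≤ d i → d i = a) :
    ∑ i ∈ s with d i = a, c i = 0 := by
  classical
  have hw' : ∀ i, ∃ p : MvPolynomial (Fin 2) K, i ∈ s → MvPolynomial.constantCoeff p = 1 ∧
      w i = Xv K 0 ^ (-(d i).1) * Xv K 1 ^ (-(d i).2) * algebraMap _ (F K) p := by
    intro i
    by_cases hi : i ∈ s
    · obtain ⟨p, hp⟩ := hw i hi
      exact ⟨p, fun _ => hp⟩
    · exact ⟨0, fun h => absurd h hi⟩
  choose p hp using hw'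
  obtain ⟨N, hNa, hN⟩ : ∃ N : ℕ, (a.1 ≤ N ∧ a.2 ≤ N) ∧
      ∀ i ∈ s, (d i).1 ≤ N ∧ (d i).2 ≤ N := by
    refine ⟨max (max a.1.toNat a.2.toNat) (s.sup fun i => max (d i).1.toNat (d i).2.toNat),
      by lia, fun i hi => ?_⟩
    have := Finset.le_sup (f := fun i => max (d i).1.toNat (d i).2.toNat) hi
    lia
  set e : ℤ × ℤ → (Fin 2 →₀ ℕ) := fun d =>
    Finsupp.single 0 (N - d.1).toNat + Finsupp.single 1 (N - d.2).toNat with he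
  have hpoly : ∑ i ∈ s, MvPolynomial.C (c i) * (MvPolynomial.monomial (e (d i)) 1 * p i) = 0 := by
    apply IsFractionRing.injective (MvPolynomial (Fin 2) K) (F K)
    rw [map_sum, map_zero, ← mul_zero (Xv K 0 ^ N * Xv K 1 ^ N), ← h, Finset.mul_sum]
    refine Finset.sum_congr rfl fun i hi => ?_
    rw [map_mul, he, ← Xv_pow_mul_zpow N (d i) (hN i hi).1 (hN i hi).2, ← (hp i hi).2, φ,
      RingHom.comp_apply]
    ring
  have hcoeff := congrArg (MvPolynomial.coeff (e a)) hpoly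
  rw [MvPolynomial.coeff_sum, MvPolynomial.coeff_zero] at hcoeff
  rw [Finset.sum_filter]
  refine Eq.trans ?_ hcoeff
  refine Finset.sum_congr rfl fun i hi => ?_
  rw [MvPolynomial.coeff_C_mul, MvPolynomial.coeff_monomial_mul']
  split_ifs with h1 h2 h2
  · have := (hp i hi).1
    rw [MvPolynomial.constantCoeff_eq] at this
    rw [h1, tsub_self, this]
    simp
  · exact absurd (h1 ▸ le_rfl) h2
  · by_cases hc : c i = 0
    · simp [hc]
    refine absurd (ha i hi hc ?_) h1
    have h0 := h2 0
    have h1' := h2 1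
    simp [he] at h0 h1'
    have := hN i hi
    constructor <;> lia
  · simp

/-- Elements with pairwise distinct denominator vectors are linearly independent. -/
lemma eq_zero_of_sum_lowest_eq_zero (w : ℤ × ℤ → F K) (hw : ∀ a, Lowest a (w a))
    (c : ℤ × ℤ →₀ K) (h : ∑ m ∈ c.support, φ K (c m) * w m = 0) : c = 0 := by
  by_contra hc
  obtain ⟨a, ha⟩ := c.support.exists_maximal (Finsupp.support_nonempty_iff.mpr hc)
  have := sum_filter_eq_zero_of_lowest c.support c id w (fun i _ => hw i) h a
    fun i hi _ hai => le_antisymm (ha.2 hi hai) hai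
  rw [Finset.sum_filter] at this
  simp at this
  exact Finsupp.mem_support_iff.mp ha.1 this

/-- Expanding an element with denominator vector `a` in a family with all denominator vectors is
unitriangular. -/
lemma lowest_triangular (w : ℤ × ℤ → F K) (hw : ∀ a, Lowest a (w a)) {a : ℤ × ℤ} {v : F K}
    (hv : Lowest a v) (c : ℤ × ℤ →₀ K) (h : v = ∑ m ∈ c.support, φ K (c m) * w m) :
    (∀ b ∈ c.support, b ≤ a) ∧ c a = 1 := by
  have key (m : ℤ × ℤ) (hm : m ≤ a → a = m) (hmax : ∀ b ∈ c.support, m ≤ b → b = m) :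
      (if a = m then -1 else 0) + c m = 0 := by
    have := sum_filter_eq_zero_of_lowest (Finset.insertNone c.support)
      (fun o => o.elim (-1) c) (fun o => o.elim a id) (fun o => o.elim v w)
      (by
        rintro (_ | b) -
        · exact hv
        · exact hw b)
      (by rw [Finset.sum_insertNone]; simp [← h]) m
      (by
        rintro (_ | b) hb - hmb
        · exact hm hmb
        · exact hmax b (Finset.some_mem_insertNone.mp hb) hmb)
    rw [Finset.sum_filter, Finset.sum_insertNone] at this
    have hsum : (∑ b ∈ c.support, if b = m then c b else 0) = c m := by
      rw [Finset.sum_ite_eq']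
      simp
    rw [← hsum]
    exact this
  have hle : ∀ b ∈ c.support, b ≤ a := by
    intro b hb
    by_contra hba
    obtain ⟨m, hbm, hm⟩ := c.support.exists_le_maximal hb
    have hma : ¬ m ≤ a := fun hma => hba (hbm.trans hma)
    have := key m (fun h => absurd h hma) fun b hb hmb => le_antisymm (hm.2 hb hmb) hmb
    rw [if_neg (fun h => hma h.ge), zero_add] at this
    exact Finsupp.mem_support_iff.mp hm.1 this
  refine ⟨hle, ?_⟩
  have := key a (fun _ => rfl) fun b hb hab => le_antisymm (hle b hb) hab
  rw [if_pos rfl] at this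
  linear_combination this

lemma PointedAt.lowest {P1 P2 : K[X]} {x : ℤ → F K} (hx : ClusterSeq P1 P2 x) {a1 a2 : ℤ}
    {c : ℕ × ℕ →₀ K} {w : F K} (h : PointedAt P1 P2 x a1 a2 c w) : Lowest (a1, a2) w := by
  obtain ⟨-, h0, hw⟩ := h
  refine ⟨∑ m ∈ c.support, MvPolynomial.C (c m) * MvPolynomial.X 0 ^ m.1 *
    MvPolynomial.X 1 ^ m.2, ?_, ?_⟩
  · rw [map_sum, Finset.sum_eq_single (0, 0)]
    · simp [h0]
    · rintro ⟨i, j⟩ - hij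
      have : i ≠ 0 ∨ j ≠ 0 := by
        by_contra! hh
        exact hij (by rw [hh.1, hh.2])
      rcases this with h | h <;> simp [h]
    · intro h
      simp [h0] at h
  · rw [hw, hx.1, hx.2.1, map_sum]
    simp only [map_mul, map_pow]
    rfl

lemma Palindromic.coeff_zero {P : K[X]} (hp : Palindromic P) (hm : P.Monic) : P.coeff 0 = 1 := by
  rw [hp 0 (Nat.zero_le _), Nat.sub_zero, hm.coeff_natDegree]

/-- The polynomial `P(x_i)` in an initial variable `x_i` is a polynomial with constant
term `P(0)`. -/
lemma lowest_eval₂ {P : K[X]} (h0 : P.coeff 0 = 1) (i : Fin 2) :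
    Lowest 0 (P.eval₂ (φ K) (Xv K i)) := by
  refine ⟨P.eval₂ MvPolynomial.C (MvPolynomial.X i), ?_, ?_⟩
  · rw [Polynomial.hom_eval₂]
    simp only [MvPolynomial.constantCoeff_comp_C, MvPolynomial.constantCoeff_X]
    rw [Polynomial.eval₂_id, ← Polynomial.coeff_zero_eq_eval_zero, h0]
  · rw [Polynomial.hom_eval₂]
    simp [φ, Xv]

lemma lowest_Xv_zero : Lowest (-1, 0) (Xv K 0) := ⟨1, by simp, by simp⟩

lemma lowest_Xv_one : Lowest (0, -1) (Xv K 1) := ⟨1, by simp, by simp⟩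

lemma lowest_Xv_zero_inv : Lowest (1, 0) (Xv K 0)⁻¹ := ⟨1, by simp, by simp⟩

lemma lowest_Xv_one_inv : Lowest (0, 1) (Xv K 1)⁻¹ := ⟨1, by simp, by simp⟩

/-- The standard monomials have lowest terms with the expected exponents. -/
lemma lowest_zmon {P1 P2 : K[X]} {x : ℤ → F K} (h1 : P1.coeff 0 = 1) (h2 : P2.coeff 0 = 1)
    (hx : ClusterSeq P1 P2 x) (a : ℤ × ℤ) : Lowest a (zmon x 1 a.1 a.2) := by
  obtain ⟨hx1, hx2, -, hrec⟩ := hx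
  have e1 := hrec 1
  have e2 := hrec 2
  norm_num [hx1, hx2] at e1 e2
  have l0 : Lowest (0, 1) (x 0) := by
    rw [show x 0 = (Xv K 1)⁻¹ * P2.eval₂ (φ K) (Xv K 0) by
      rw [← e1, inv_mul_cancel_left₀ (Xv_ne_zero 1)]]
    exact lowest_Xv_one_inv.mul (lowest_eval₂ h2 0)
  have l3 : Lowest (1, 0) (x 3) := by
    rw [show x 3 = P1.eval₂ (φ K) (Xv K 1) * (Xv K 0)⁻¹ by
      rw [← e2, mul_inv_cancel_right₀ (Xv_ne_zero 0)]]
    simpa using (lowest_eval₂ h1 1).mul lowest_Xv_zero_inv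
  have := (((l0.pow (max a.2 0).toNat).mul (lowest_Xv_zero.pow (max (-a.1) 0).toNat)).mul
    (lowest_Xv_one.pow (max (-a.2) 0).toNat)).mul (l3.pow (max a.1 0).toNat)
  rw [← hx1, ← hx2] at this
  convert this using 1
  · ext <;> simp <;> lia
  · simp [zmon]

lemma eval₂_mem {P : K[X]} {S : Subring (F K)} (hP : ∀ t, φ K (P.coeff t) ∈ S) {a : F K}
    (ha : a ∈ S) : P.eval₂ (φ K) a ∈ S := by
  rw [Polynomial.eval₂_eq_sum_range]
  exact S.sum_mem fun i _ => S.mul_mem (hP i) (S.pow_mem ha i)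

/-- Four consecutive cluster variables generate the next one. -/
lemma next_mem {P Q : K[X]} (h0 : P.coeff 0 = 1) (hQ : Palindromic Q) {S : Subring (F K)}
    (hPS : ∀ t, φ K (P.coeff t) ∈ S) (hQS : ∀ t, φ K (Q.coeff t) ∈ S)
    {a0 a1 a2 a3 a4 : F K} (m0 : a0 ∈ S) (m1 : a1 ∈ S) (m2 : a2 ∈ S) (m3 : a3 ∈ S)
    (hne : a2 ≠ 0) (e1 : a0 * a2 = Q.eval₂ (φ K) a1) (e2 : a1 * a3 = P.eval₂ (φ K) a2)
    (e3 : a2 * a4 = Q.eval₂ (φ K) a3) : a4 ∈ S := by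
  obtain ⟨r, hr, hr'⟩ : ∃ r ∈ S, a1 * a3 - 1 = a2 * r := by
    refine ⟨P.divX.eval₂ (φ K) a2, eval₂_mem (fun t => ?_) m2, ?_⟩
    · rw [Polynomial.coeff_divX]
      exact hPS _
    · rw [e2]
      conv_lhs => rw [← P.divX_mul_X_add]
      rw [Polynomial.eval₂_add, Polynomial.eval₂_mul, Polynomial.eval₂_X, Polynomial.eval₂_C, h0,
        map_one]
      ring
  have hpow (i : ℕ) : ∃ s ∈ S, (a1 * a3) ^ i = 1 + a2 * s := by
    refine ⟨r * ∑ j ∈ Finset.range i, (a1 * a3) ^ j, S.mul_mem hr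
      (S.sum_mem fun j _ => S.pow_mem (S.mul_mem m1 m3) j), ?_⟩
    have := mul_geom_sum (a1 * a3) i
    rw [hr'] at this
    linear_combination -this
  choose s hs hs' using hpow
  have hrev : Q.eval₂ (φ K) a3 =
      ∑ i ∈ Finset.range (Q.natDegree + 1), φ K (Q.coeff i) * a3 ^ (Q.natDegree - i) := by
    rw [Polynomial.eval₂_eq_sum_range, ← Finset.sum_range_reflect]
    refine Finset.sum_congr rfl fun i hi => ?_
    have hi' : i ≤ Q.natDegree := Nat.lt_succ_iff.mp (Finset.mem_range.mp hi)
    rw [Nat.add_sub_cancel, ← hQ i hi']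
  have key : a4 = a3 ^ Q.natDegree * a0 -
      ∑ i ∈ Finset.range (Q.natDegree + 1),
        φ K (Q.coeff i) * a3 ^ (Q.natDegree - i) * s i := by
    apply mul_left_cancel₀ hne
    rw [e3, hrev, mul_sub, show a2 * (a3 ^ Q.natDegree * a0) = a3 ^ Q.natDegree * (a0 * a2) by ring,
      e1, Polynomial.eval₂_eq_sum_range, Finset.mul_sum, Finset.mul_sum, ← Finset.sum_sub_distrib]
    refine Finset.sum_congr rfl fun i hi => ?_
    have hi' : i ≤ Q.natDegree := Nat.lt_succ_iff.mp (Finset.mem_range.mp hi)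
    have h1 : a3 ^ Q.natDegree = a3 ^ (Q.natDegree - i) * a3 ^ i := by
      rw [← pow_add, Nat.sub_add_cancel hi']
    have h2 := hs' i
    rw [mul_pow] at h2
    rw [h1]
    linear_combination (-φ K (Q.coeff i) * a3 ^ (Q.natDegree - i)) * h2
  rw [key]
  exact S.sub_mem (S.mul_mem (S.pow_mem m3 _) m0)
    (S.sum_mem fun i _ => S.mul_mem (S.mul_mem (hQS i) (S.pow_mem m3 _)) (hs i))

/-- A subring containing the coefficients and `x 0, x 1, x 2, x 3` contains all cluster
variables. -/
lemma cluster_mem {P1 P2 : K[X]} {x : ℤ → F K} (h1 : P1.coeff 0 = 1) (h2 : P2.coeff 0 = 1)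
    (hp1 : Palindromic P1) (hp2 : Palindromic P2) (hx : ClusterSeq P1 P2 x) {S : Subring (F K)}
    (hS1 : ∀ t, φ K (P1.coeff t) ∈ S) (hS2 : ∀ t, φ K (P2.coeff t) ∈ S)
    (m0 : x 0 ∈ S) (m1 : x 1 ∈ S) (m2 : x 2 ∈ S) (m3 : x 3 ∈ S) (k : ℤ) : x k ∈ S := by
  obtain ⟨-, -, hne, hrec⟩ := hx
  have step (k e : ℤ) (he : e = 1 ∨ e = -1) (n0 : x (k - 2 * e) ∈ S) (n1 : x (k - e) ∈ S)
      (n2 : x k ∈ S) (n3 : x (k + e) ∈ S) : x (k + 2 * e) ∈ S := by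
    have e1 : x (k - 2 * e) * x k = if Even (k - e) then P1.eval₂ (φ K) (x (k - e))
        else P2.eval₂ (φ K) (x (k - e)) := by
      have := hrec (k - e)
      rcases he with rfl | rfl
      · rw [mul_comm]; convert this using 3 <;> ring
      · convert this using 3 <;> ring
    have e2 : x (k - e) * x (k + e) = if Even k then P1.eval₂ (φ K) (x k)
        else P2.eval₂ (φ K) (x k) := by
      have := hrec k
      rcases he with rfl | rfl
      · rw [mul_comm]; exact this
      · convert this using 3 <;> ring
    have e3 : x k * x (k + 2 * e) = if Even (k + e) then P1.eval₂ (φ K) (x (k + e))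
        else P2.eval₂ (φ K) (x (k + e)) := by
      have := hrec (k + e)
      rcases he with rfl | rfl
      · rw [mul_comm]; convert this using 3 <;> ring
      · convert this using 3 <;> ring
    rcases Int.even_or_odd k with hk | hk
    · have a1 : ¬ Even (k - e) := by rcases he with rfl | rfl <;> grind
      have a3 : ¬ Even (k + e) := by rcases he with rfl | rfl <;> grind
      rw [if_neg a1] at e1
      rw [if_pos hk] at e2
      rw [if_neg a3] at e3
      exact next_mem h1 hp2 hS1 hS2 n0 n1 n2 n3 (hne k) e1 e2 e3
    · have a1 : Even (k - e) := by rcases he with rfl | rfl <;> grind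
      have a3 : Even (k + e) := by rcases he with rfl | rfl <;> grind
      rw [if_pos a1] at e1
      rw [if_neg (Int.not_even_iff_odd.mpr hk)] at e2
      rw [if_pos a3] at e3
      exact next_mem h2 hp1 hS2 hS1 n0 n1 n2 n3 (hne k) e1 e2 e3
  have up (n : ℕ) : x n ∈ S ∧ x (n + 1) ∈ S ∧ x (n + 2) ∈ S ∧ x (n + 3) ∈ S := by
    induction n with
    | zero => simpa using ⟨m0, m1, m2, m3⟩
    | succ n ih =>
      obtain ⟨i0, i1, i2, i3⟩ := ih
      have := step (n + 2) 1 (Or.inl rfl) (by convert i0 using 2; ring)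
        (by convert i1 using 2; ring) i2 (by convert i3 using 2; ring)
      push_cast
      refine ⟨i1, ?_, ?_, ?_⟩
      · convert i2 using 2; ring
      · convert i3 using 2; ring
      · convert this using 2; ring
  have down (n : ℕ) : x (-n) ∈ S ∧ x (-n + 1) ∈ S ∧ x (-n + 2) ∈ S ∧ x (-n + 3) ∈ S := by
    induction n with
    | zero => simpa using ⟨m0, m1, m2, m3⟩
    | succ n ih =>
      obtain ⟨i0, i1, i2, i3⟩ := ih
      have := step (-n + 1) (-1) (Or.inr rfl) (by convert i3 using 2; ring)
        (by convert i2 using 2; ring) i1 (by convert i0 using 2; ring)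
      push_cast
      refine ⟨?_, ?_, ?_, ?_⟩
      · convert this using 2; ring
      · convert i0 using 2; ring
      · convert i1 using 2; ring
      · convert i2 using 2; ring
  obtain ⟨n, rfl | rfl⟩ := k.eq_nat_or_neg
  · exact (up n).1
  · exact (down n).1

/-- The span of the standard monomials `z_1[a1,a2]` over the coefficient ring. -/
abbrev zspan (P1 P2 : K[X]) (x : ℤ → F K) : Submodule (uK P1 P2) (F K) :=
  Submodule.span (uK P1 P2) (Set.range fun a : ℤ × ℤ => zmon x 1 a.1 a.2)

lemma eval₂_mul_mem {P1 P2 P : K[X]} (hP : ∀ t, P.coeff t ∈ uK P1 P2)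
    (V : Submodule (uK P1 P2) (F K)) {a w : F K} (h : ∀ i : ℕ, a ^ i * w ∈ V) :
    P.eval₂ (φ K) a * w ∈ V := by
  rw [Polynomial.eval₂_eq_sum_range, Finset.sum_mul]
  refine V.sum_mem fun i _ => ?_
  have := V.smul_mem ⟨_, hP i⟩ (h i)
  rwa [smul_eq_φ_mul, ← mul_assoc] at this

lemma coeff_left_mem_uK (P1 P2 : K[X]) (t : ℕ) : P1.coeff t ∈ uK P1 P2 :=
  Subring.subset_closure (Or.inl ⟨t, rfl⟩)

lemma coeff_right_mem_uK (P1 P2 : K[X]) (t : ℕ) : P2.coeff t ∈ uK P1 P2 :=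
  Subring.subset_closure (Or.inr ⟨t, rfl⟩)

lemma monomial_mem_zspan {P1 P2 : K[X]} {x : ℤ → F K} (hx : ClusterSeq P1 P2 x)
    (a b c d : ℕ) : x 0 ^ a * x 1 ^ b * x 2 ^ c * x 3 ^ d ∈ zspan P1 P2 x := by
  have e1 := hx.2.2.2 1
  have e2 := hx.2.2.2 2
  norm_num at e1 e2
  induction hn : a + d generalizing a b c d with
  | zero =>
    refine Submodule.subset_span ⟨(-b, -c), ?_⟩
    have : a = 0 ∧ d = 0 := by lia
    simp [zmon, this]
  | succ n ih =>
    by_cases hac : 0 < a ∧ 0 < c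
    · obtain ⟨a, rfl⟩ := Nat.exists_eq_succ_of_ne_zero hac.1.ne'
      obtain ⟨c, rfl⟩ := Nat.exists_eq_succ_of_ne_zero hac.2.ne'
      have := eval₂_mul_mem (coeff_right_mem_uK P1 P2) (zspan P1 P2 x) (a := x 1)
        (w := x 0 ^ a * x 1 ^ b * x 2 ^ c * x 3 ^ d) fun i => by
          convert ih a (b + i) c d (by lia) using 1; ring
      rw [← e1] at this
      convert this using 1
      rw [Nat.succ_eq_add_one, Nat.succ_eq_add_one]
      ring
    by_cases hbd : 0 < b ∧ 0 < d
    · obtain ⟨b, rfl⟩ := Nat.exists_eq_succ_of_ne_zero hbd.1.ne'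
      obtain ⟨d, rfl⟩ := Nat.exists_eq_succ_of_ne_zero hbd.2.ne'
      have := eval₂_mul_mem (coeff_left_mem_uK P1 P2) (zspan P1 P2 x) (a := x 2)
        (w := x 0 ^ a * x 1 ^ b * x 2 ^ c * x 3 ^ d) fun i => by
          convert ih a b (c + i) d (by lia) using 1; ring
      rw [← e2] at this
      convert this using 1
      rw [Nat.succ_eq_add_one, Nat.succ_eq_add_one]
      ring
    refine Submodule.subset_span ⟨((d : ℤ) - b, (a : ℤ) - c), ?_⟩
    have i0 : (max ((a : ℤ) - c) 0).toNat = a := by lia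
    have i1 : (max (-((d : ℤ) - b)) 0).toNat = b := by lia
    have i2 : (max (-((a : ℤ) - c)) 0).toNat = c := by lia
    have i3 : (max ((d : ℤ) - b) 0).toNat = d := by lia
    simp only [zmon, i0, i1, i2, i3]
    norm_num

/-- The standard monomials span the cluster algebra. -/
lemma mem_zspan_of_mem_clA {P1 P2 : K[X]} {x : ℤ → F K} (h1 : P1.coeff 0 = 1)
    (h2 : P2.coeff 0 = 1) (hp1 : Palindromic P1) (hp2 : Palindromic P2)
    (hx : ClusterSeq P1 P2 x) {w : F K} (hw : w ∈ clA P1 P2 x) : w ∈ zspan P1 P2 x := by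
  set B : Subalgebra (uK P1 P2) (F K) := Algebra.adjoin _ {x 0, x 1, x 2, x 3} with hB
  have hφ : ∀ r ∈ uK P1 P2, φ K r ∈ B.toSubring := fun r hr => by
    have := B.algebraMap_mem ⟨r, hr⟩
    rwa [Algebra.algebraMap_eq_smul_one, smul_eq_φ_mul, mul_one] at this
  have hle : clA P1 P2 x ≤ B.toSubring := by
    refine Subring.closure_le.mpr ?_
    rintro v (⟨r, hr, rfl⟩ | ⟨k, rfl⟩)
    · exact hφ r hr
    · exact cluster_mem h1 h2 hp1 hp2 hx (fun t => hφ _ (coeff_left_mem_uK P1 P2 t))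
        (fun t => hφ _ (coeff_right_mem_uK P1 P2 t)) (Algebra.subset_adjoin (by simp))
        (Algebra.subset_adjoin (by simp)) (Algebra.subset_adjoin (by simp))
        (Algebra.subset_adjoin (by simp)) k
  have hwB : w ∈ Subalgebra.toSubmodule B := hle hw
  rw [hB, Algebra.adjoin_eq_span] at hwB
  refine Submodule.span_le.mpr (fun v hv => ?_) hwB
  obtain ⟨a, b, c, d, rfl⟩ : ∃ a b c d : ℕ, v = x 0 ^ a * x 1 ^ b * x 2 ^ c * x 3 ^ d := by
    induction hv using Submonoid.closure_induction with
    | mem v hv =>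
      rcases hv with rfl | rfl | rfl | rfl
      · exact ⟨1, 0, 0, 0, by simp⟩
      · exact ⟨0, 1, 0, 0, by simp⟩
      · exact ⟨0, 0, 1, 0, by simp⟩
      · exact ⟨0, 0, 0, 1, by simp⟩
    | one => exact ⟨0, 0, 0, 0, by simp⟩
    | mul v w _ _ hv hw =>
      obtain ⟨a, b, c, d, rfl⟩ := hv
      obtain ⟨a', b', c', d', rfl⟩ := hw
      exact ⟨a + a', b + b', c + c', d + d', by ring⟩
  exact monomial_mem_zspan hx a b c d

lemma exists_finsupp_of_mem_span (S : Subring K) {ι : Type*} (v : ι → F K) {w : F K}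
    (hw : w ∈ Submodule.span S (Set.range v)) :
    ∃ c : ι →₀ K, (∀ m, c m ∈ S) ∧ w = ∑ m ∈ c.support, φ K (c m) * v m := by
  obtain ⟨c, rfl⟩ := Finsupp.mem_span_range_iff_exists_finsupp.mp hw
  refine ⟨c.mapRange (fun r : S => (r : K)) rfl, fun m => by simp, ?_⟩
  rw [Finsupp.support_mapRange_of_injective _ _ Subtype.val_injective, Finsupp.sum]
  refine Finset.sum_congr rfl fun m _ => ?_
  rw [smul_eq_φ_mul, Finsupp.mapRange_apply]

end LowestTerms


/-- Any complete bounded collection of pointed elements of `A(P1,P2)` is an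
`underline-K`-basis of `A(P1,P2)`. -/
theorem bounded_pointed_collection_is_basis {K : Type*} [Field K] [CharZero K]
    (P1 P2 : K[X])
    (hm1 : P1.Monic) (hm2 : P2.Monic) (hp1 : Palindromic P1) (hp2 : Palindromic P2)
    (x : ℤ → F K) (hx : ClusterSeq P1 P2 x)
    (y : ℤ → ℤ → F K)
    (hyA : ∀ a1 a2 : ℤ, y a1 a2 ∈ clA P1 P2 x)
    (hyP : ∀ a1 a2 : ℤ, ∃ c : ℕ × ℕ →₀ K, PointedAt P1 P2 x a1 a2 c (y a1 a2))
    (hyB : ∀ a1 a2 : ℤ, ¬(0 < a1 ∧ 0 < a2) → y a1 a2 = zmon x 1 a1 a2) :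
    (∀ c : ℤ × ℤ →₀ K, (∀ m, c m ∈ uK P1 P2) →
        ∑ m ∈ c.support, φ K (c m) * y m.1 m.2 = 0 → c = 0) ∧
    (∀ w ∈ clA P1 P2 x, ∃ c : ℤ × ℤ →₀ K, (∀ m, c m ∈ uK P1 P2) ∧
        w = ∑ m ∈ c.support, φ K (c m) * y m.1 m.2) := by
  have h1 := hp1.coeff_zero hm1
  have h2 := hp2.coeff_zero hm2
  have hylow (a : ℤ × ℤ) : Lowest a (y a.1 a.2) := by
    obtain ⟨c, hc⟩ := hyP a.1 a.2
    exact hc.lowest hx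
  refine ⟨fun c _ h => eq_zero_of_sum_lowest_eq_zero _ hylow c h, fun w hw => ?_⟩
  refine exists_finsupp_of_mem_span (uK P1 P2) (fun m : ℤ × ℤ => y m.1 m.2) ?_
  set V := Submodule.span (uK P1 P2) (Set.range fun m : ℤ × ℤ => y m.1 m.2) with hV
  have hyV (a : ℤ × ℤ) : y a.1 a.2 ∈ V := Submodule.subset_span ⟨a, rfl⟩
  have hzV (n : ℕ) : ∀ a : ℤ × ℤ, (a.1 + a.2).toNat = n → zmon x 1 a.1 a.2 ∈ V := by
    induction n using Nat.strong_induction_on with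
    | _ n ih =>
      intro a ha
      by_cases hpos : 0 < a.1 ∧ 0 < a.2
      swap
      · rw [← hyB _ _ hpos]
        exact hyV a
      obtain ⟨c, hcK, hc⟩ := exists_finsupp_of_mem_span _ _
        (mem_zspan_of_mem_clA h1 h2 hp1 hp2 hx (hyA a.1 a.2))
      obtain ⟨hle, hca⟩ := lowest_triangular _ (lowest_zmon h1 h2 hx) (hylow a) c hc
      rw [← Finset.add_sum_erase _ _ (Finsupp.mem_support_iff.mpr (by simp [hca] : c a ≠ 0)),
        hca, map_one, one_mul] at hc
      rw [← sub_eq_of_eq_add hc]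
      refine V.sub_mem (hyV a) (V.sum_mem fun b hb => ?_)
      obtain ⟨hba, hb⟩ := Finset.mem_erase.mp hb
      rw [← smul_eq_φ_mul (uK P1 P2) ⟨c b, hcK b⟩]
      refine V.smul_mem _ ?_
      by_cases hbpos : 0 < b.1 ∧ 0 < b.2
      · refine ih _ ?_ b rfl
        obtain ⟨hl1, hl2⟩ := hle b hb
        have : b.1 ≠ a.1 ∨ b.2 ≠ a.2 := by
          by_contra! h
          exact hba (Prod.ext h.1 h.2)
        lia
      · rw [← hyB _ _ hbpos]
        exact hyV b
  refine Submodule.span_le.mpr ?_ (mem_zspan_of_mem_clA h1 h2 hp1 hp2 hx hw)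
  rintro _ ⟨a, rfl⟩
  exact hzV _ a rfl

end GCA
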